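/- Let U : ℝ^{d_θ} × ℝ^{d_x} → ℝ be differentiable with Lipschitz gradient (‖∇U(θ,x) − ∇U(θ',x')‖ ≤ L_θ‖θ−θ'‖ + L_x‖x−x'‖) and satisfy ⟨v − v', ∇U(v) − ∇U(v')⟩ ≥ μ‖v − v'‖² with μ > 0. Let k(θ) := ∫_{ℝ^{d_x}} e^{−U(θ,x)} dx, κ := −log k, and let θ* be the (unique) global minimiser of κ on ℝ^{d_θ}. For N ≥ 1 let π^N_Θ be the probability measure on ℝ^{d_θ} with Lebesgue density proportional to k(θ)^N = e^{−Nκ(θ)}. Then the second moment of π^N_Θ around θ* satisfies ∫_{ℝ^{d_θ}} ‖θ − θ*‖² π^N_Θ(dθ) ≤ 2 d_θ / (μ N); equivalently, the 2-Wasserstein distance between π^N_Θ and the Dirac mass at θ* is at most √(2 d_θ / (μ N)). -/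

import Mathlib

open MeasureTheory InnerProductSpace
open scoped RealInnerProductSpace ENNReal

noncomputable section

/-- The joint Euclidean space `ℝ^{d_θ} × ℝ^{d_x}`, equipped with the ℓ²-(Euclidean) norm. -/
abbrev PairSp (dθ dx : ℕ) := WithLp 2 (EuclideanSpace ℝ (Fin dθ) × EuclideanSpace ℝ (Fin dx))

/-- Form the pair `v = (θ, x)` in the joint Euclidean space. -/
def mkPair {dθ dx : ℕ} (θ : EuclideanSpace ℝ (Fin dθ)) (x : EuclideanSpace ℝ (Fin dx)) :
    PairSp dθ dx := (WithLp.equiv 2 _).symm (θ, x)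

/-- The marginal likelihood `k(θ) = ∫ e^{-U(θ,x)} dx`. -/
def marginalLik {dθ dx : ℕ} (U : PairSp dθ dx → ℝ) (θ : EuclideanSpace ℝ (Fin dθ)) : ℝ :=
  ∫ x : EuclideanSpace ℝ (Fin dx), Real.exp (-U (mkPair θ x))

section PrekopaLeindler

open Set Pointwise

/-- Brunn–Minkowski on the line, for compact sets. -/
lemma Real.volume_add_volume_le_of_isCompact {K L : Set ℝ} (hK : IsCompact K) (hL : IsCompact L)
    (hK0 : K.Nonempty) (hL0 : L.Nonempty) : volume K + volume L ≤ volume (K + L) := by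
  have ha := hK.isGreatest_sSup hK0
  have hb := hL.isLeast_sInf hL0
  set a := sSup K
  set b := sInf L
  have hsub : (fun x => x + b) '' K ∪ (fun x => a + x) '' L ⊆ K + L := by
    rintro _ (⟨x, hx, rfl⟩ | ⟨x, hx, rfl⟩)
    · exact add_mem_add hx hb.1
    · exact add_mem_add ha.1 hx
  have hint : (fun x => x + b) '' K ∩ (fun x => a + x) '' L ⊆ {a + b} := by
    rintro _ ⟨⟨x, hx, rfl⟩, ⟨y, hy, hxy⟩⟩
    have h1 := ha.2 hx
    have h2 := hb.2 hy
    simp only [mem_singleton_iff] at *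
    linarith
  have hae : AEDisjoint volume ((fun x => x + b) '' K) ((fun x => a + x) '' L) :=
    measure_mono_null hint (by simp)
  calc volume K + volume L
      = volume ((fun x => x + b) '' K) + volume ((fun x => a + x) '' L) := by
        rw [image_add_right, image_add_left, measure_preimage_add_right, measure_preimage_add]
    _ = volume ((fun x => x + b) '' K ∪ (fun x => a + x) '' L) := by
        rw [measure_union₀ _ hae]
        exact (hL.image (by fun_prop)).measurableSet.nullMeasurableSet
    _ ≤ _ := measure_mono hsub

/-- Brunn–Minkowski on the line. -/
lemma Real.volume_add_volume_le {A B C : Set ℝ} (hA : MeasurableSet A) (hB : MeasurableSet B)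
    (hA0 : A.Nonempty) (hB0 : B.Nonempty) (h : A + B ⊆ C) :
    volume A + volume B ≤ volume C := by
  obtain ⟨x, hx⟩ := hA0
  obtain ⟨y, hy⟩ := hB0
  rw [hA.measure_eq_iSup_isCompact, hB.measure_eq_iSup_isCompact]
  simp only [iSup_and']
  refine ENNReal.biSup_add_biSup_le' ⟨∅, empty_subset _, isCompact_empty⟩
    ⟨∅, empty_subset _, isCompact_empty⟩ fun K ⟨hKA, hK⟩ L ⟨hLB, hL⟩ => ?_
  calc volume K + volume L ≤ volume (insert x K) + volume (insert y L) :=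
        add_le_add (measure_mono (subset_insert _ _)) (measure_mono (subset_insert _ _))
    _ ≤ volume (insert x K + insert y L) :=
        Real.volume_add_volume_le_of_isCompact (hK.insert x) (hL.insert y)
          (insert_nonempty _ _) (insert_nonempty _ _)
    _ ≤ volume C := measure_mono ((add_subset_add (insert_subset hx hKA)
        (insert_subset hy hLB)).trans h)

/-- The Prékopa–Leindler inequality as a property of a measured real vector space. -/
def PrekopaLeindler (E : Type*) [AddCommGroup E] [Module ℝ E] [MeasureSpace E] : Prop :=
  ∀ ⦃a b : ℝ⦄, 0 < a → 0 < b → a + b = 1 → ∀ ⦃f g h : E → ℝ≥0∞⦄,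
    Measurable f → Measurable g → Measurable h →
    (∀ x y, f x ^ a * g y ^ b ≤ h (a • x + b • y)) →
    (∫⁻ x, f x) ^ a * (∫⁻ x, g x) ^ b ≤ ∫⁻ x, h x

lemma ENNReal.rpow_mul_rpow_le_add {a b : ℝ} (ha : 0 < a) (hb : 0 < b) (hab : a + b = 1)
    (x y : ℝ≥0∞) : x ^ a * y ^ b ≤ ENNReal.ofReal a * x + ENNReal.ofReal b * y := by
  have h := ENNReal.young_inequality (x ^ a) (y ^ b) (p := a⁻¹) (q := b⁻¹)
    (Real.holderConjugate_iff.2 ⟨(one_lt_inv₀ ha).2 (by linarith), by simpa⟩)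
  rw [← ENNReal.rpow_mul, ← ENNReal.rpow_mul, mul_inv_cancel₀ ha.ne', mul_inv_cancel₀ hb.ne',
    ENNReal.rpow_one, ENNReal.rpow_one, ENNReal.ofReal_inv_of_pos ha,
    ENNReal.ofReal_inv_of_pos hb, div_eq_mul_inv, div_eq_mul_inv, inv_inv, inv_inv] at h
  rwa [mul_comm x, mul_comm y] at h

lemma lintegral_eq_lintegral_Ioo_of_le_one {α : Type*} [MeasurableSpace α] {ν : Measure α}
    {f : α → ℝ≥0∞} (hf : Measurable f) (hf1 : ∀ x, f x ≤ 1) :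
    ∫⁻ x, f x ∂ν = ∫⁻ t in Ioo (0 : ℝ) 1, ν {x | ENNReal.ofReal t < f x} := by
  have hfin : ∀ x, f x ≠ ∞ := fun x => ne_top_of_le_ne_top ENNReal.one_ne_top (hf1 x)
  have h := lintegral_eq_lintegral_meas_lt ν (f := fun x => (f x).toReal)
    (Filter.Eventually.of_forall fun x => ENNReal.toReal_nonneg) hf.ennreal_toReal.aemeasurable
  simp only [ENNReal.ofReal_toReal (hfin _)] at h
  rw [h, ← Ioo_union_Ici_eq_Ioi zero_lt_one, lintegral_union measurableSet_Ici]
  · rw [setLIntegral_congr_fun (g := fun _ => 0) measurableSet_Ici]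
    · rw [lintegral_zero, add_zero]
      refine setLIntegral_congr_fun measurableSet_Ioo fun t ht => ?_
      simp only [ENNReal.ofReal_lt_iff_lt_toReal ht.1.le (hfin _)]
    · intro t ht
      have : {x | t < (f x).toReal} = ∅ := by
        ext x
        have := ENNReal.toReal_mono ENNReal.one_ne_top (hf1 x)
        simp only [mem_Ici, ENNReal.toReal_one, mem_ofPred_eq, mem_empty_iff_false,
          iff_false, not_lt] at *
        linarith
      simp [this]
  · exact disjoint_left.2 fun t ht ht' => absurd ht.2 (not_lt.2 ht')

lemma lintegral_real_add_le_of_iSup_eq_one {a b : ℝ} (ha : 0 < a) (hb : 0 < b) (hab : a + b = 1)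
    {f g h : ℝ → ℝ≥0∞} (hf : Measurable f) (hg : Measurable g) (hh : Measurable h)
    (hfgh : ∀ x y, f x ^ a * g y ^ b ≤ h (a • x + b • y))
    (hf1 : ⨆ x, f x = 1) (hg1 : ⨆ x, g x = 1) :
    ENNReal.ofReal a * (∫⁻ x, f x) + ENNReal.ofReal b * (∫⁻ x, g x) ≤ ∫⁻ x, h x := by
  have hfle : ∀ x, f x ≤ 1 := fun x => hf1 ▸ le_iSup f x
  have hgle : ∀ x, g x ≤ 1 := fun x => hg1 ▸ le_iSup g x
  refine le_trans ?_ (lintegral_mono (f := fun x => min (h x) 1) fun x => min_le_left _ _)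
  rw [lintegral_eq_lintegral_Ioo_of_le_one hf hfle, lintegral_eq_lintegral_Ioo_of_le_one hg hgle,
    lintegral_eq_lintegral_Ioo_of_le_one (hh.min measurable_const) fun x => min_le_right _ _,
    ← lintegral_const_mul' _ _ ENNReal.ofReal_ne_top,
    ← lintegral_const_mul' _ _ ENNReal.ofReal_ne_top, ← lintegral_add_left]
  · refine setLIntegral_mono' measurableSet_Ioo fun t ht => ?_
    have ht1 : ENNReal.ofReal t < 1 := by simpa using ht.2
    have hvol : ∀ {r : ℝ} (_ : 0 < r) (s : Set ℝ),
        volume (r • s) = ENNReal.ofReal r * volume s := by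
      intro r hr s
      simp [Measure.addHaar_smul_of_nonneg volume hr.le]
    rw [← hvol ha, ← hvol hb]
    refine Real.volume_add_volume_le ((measurableSet_lt measurable_const hf).const_smul₀ a)
      ((measurableSet_lt measurable_const hg).const_smul₀ b) ?_ ?_ ?_
    · obtain ⟨x, hx⟩ := lt_iSup_iff.1 (hf1 ▸ ht1)
      exact Nonempty.smul_set ⟨x, hx⟩
    · obtain ⟨x, hx⟩ := lt_iSup_iff.1 (hg1 ▸ ht1)
      exact Nonempty.smul_set ⟨x, hx⟩
    · rintro _ ⟨_, ⟨x, hx, rfl⟩, _, ⟨y, hy, rfl⟩, rfl⟩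
      refine lt_min (lt_of_lt_of_le ?_ (hfgh x y)) ht1
      have htop := (ENNReal.ofReal_ne_top (r := t))
      have ht0 : ENNReal.ofReal t ≠ 0 := by simpa using ht.1
      calc ENNReal.ofReal t = ENNReal.ofReal t ^ a * ENNReal.ofReal t ^ b := by
            rw [← ENNReal.rpow_add _ _ ht0 htop, hab, ENNReal.rpow_one]
        _ < _ := ENNReal.mul_lt_mul (ENNReal.rpow_lt_rpow hx ha) (ENNReal.rpow_lt_rpow hy hb)
  · refine Measurable.const_mul (Antitone.measurable fun s t hst => ?_) _
    exact measure_mono fun x hx => lt_of_le_of_lt (ENNReal.ofReal_le_ofReal hst) hx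

lemma lintegral_real_rpow_mul_rpow_le_of_iSup_ne_top {a b : ℝ} (ha : 0 < a) (hb : 0 < b)
    (hab : a + b = 1) {f g h : ℝ → ℝ≥0∞} (hf : Measurable f) (hg : Measurable g)
    (hh : Measurable h) (hfgh : ∀ x y, f x ^ a * g y ^ b ≤ h (a • x + b • y))
    (hf1 : ⨆ x, f x ≠ ∞) (hg1 : ⨆ x, g x ≠ ∞) :
    (∫⁻ x, f x) ^ a * (∫⁻ x, g x) ^ b ≤ ∫⁻ x, h x := by
  by_cases hf0 : ⨆ x, f x = 0
  · simp [ENNReal.iSup_eq_zero.1 hf0, ENNReal.zero_rpow_of_pos ha]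
  by_cases hg0 : ⨆ x, g x = 0
  · simp [ENNReal.iSup_eq_zero.1 hg0, ENNReal.zero_rpow_of_pos hb]
  set F := ⨆ x, f x with hF
  set G := ⨆ x, g x with hG
  have key := (ENNReal.rpow_mul_rpow_le_add ha hb hab _ _).trans
    (lintegral_real_add_le_of_iSup_eq_one ha hb hab (f := fun x => F⁻¹ * f x)
      (g := fun x => G⁻¹ * g x) (h := fun x => (F⁻¹ ^ a * G⁻¹ ^ b) * h x)
      (hf.const_mul _) (hg.const_mul _) (hh.const_mul _) ?_ ?_ ?_)
  · rw [lintegral_const_mul _ hf, lintegral_const_mul _ hg, lintegral_const_mul _ hh,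
      ENNReal.mul_rpow_of_nonneg _ _ ha.le, ENNReal.mul_rpow_of_nonneg _ _ hb.le,
      mul_mul_mul_comm] at key
    refine (ENNReal.mul_le_mul_iff_right ?_ ?_).1 key
    · simp [hf1, hg1, ha.le, hb.le, ha, hb]
    · exact ENNReal.mul_ne_top (ENNReal.rpow_ne_top_of_nonneg ha.le (by simpa using hf0))
        (ENNReal.rpow_ne_top_of_nonneg hb.le (by simpa using hg0))
  · intro x y
    rw [ENNReal.mul_rpow_of_nonneg _ _ ha.le, ENNReal.mul_rpow_of_nonneg _ _ hb.le,
      mul_mul_mul_comm]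
    gcongr
    exact hfgh x y
  · rw [← ENNReal.mul_iSup, ← hF, ENNReal.inv_mul_cancel hf0 hf1]
  · rw [← ENNReal.mul_iSup, ← hG, ENNReal.inv_mul_cancel hg0 hg1]

lemma ENNReal.iSup_min_natCast (x : ℝ≥0∞) : ⨆ n : ℕ, min x n = x := by
  rw [← inf_iSup_eq, ENNReal.iSup_natCast, inf_top_eq]

lemma lintegral_eq_iSup_min_natCast {α : Type*} [MeasurableSpace α] {ν : Measure α}
    {f : α → ℝ≥0∞} (hf : Measurable f) : ∫⁻ x, f x ∂ν = ⨆ n : ℕ, ∫⁻ x, min (f x) n ∂ν := by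
  rw [← lintegral_iSup fun n => hf.min measurable_const]
  · simp only [ENNReal.iSup_min_natCast]
  · intro m n hmn x
    exact min_le_min_left _ (by exact_mod_cast hmn)

theorem prekopaLeindler_real : PrekopaLeindler ℝ := by
  intro a b ha hb hab f g h hf hg hh hfgh
  have hsup : ∀ {r : ℝ} (_ : 0 < r) (u : ℕ → ℝ≥0∞), (⨆ n, u n) ^ r = ⨆ n, u n ^ r :=
    fun hr u => (ENNReal.orderIsoRpow _ hr).map_iSup u
  rw [lintegral_eq_iSup_min_natCast hf, lintegral_eq_iSup_min_natCast hg, hsup ha, hsup hb,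
    ENNReal.iSup_mul]
  refine iSup_le fun m => ?_
  rw [ENNReal.mul_iSup]
  refine iSup_le fun n => ?_
  refine lintegral_real_rpow_mul_rpow_le_of_iSup_ne_top ha hb hab (hf.min measurable_const)
    (hg.min measurable_const) hh (fun x y => le_trans ?_ (hfgh x y))
    (ne_top_of_le_ne_top (ENNReal.natCast_ne_top m) (iSup_le fun x => min_le_right _ _))
    (ne_top_of_le_ne_top (ENNReal.natCast_ne_top n) (iSup_le fun x => min_le_right _ _))
  gcongr <;> exact min_le_left _ _

theorem PrekopaLeindler.prod {E F : Type*} [AddCommGroup E] [Module ℝ E] [MeasureSpace E]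
    [AddCommGroup F] [Module ℝ F] [MeasureSpace F] [SFinite (volume : Measure E)]
    [SFinite (volume : Measure F)] (hE : PrekopaLeindler E) (hF : PrekopaLeindler F) :
    PrekopaLeindler (E × F) := by
  intro a b ha hb hab f g h hf hg hh hfgh
  simp only [Measure.volume_eq_prod]
  rw [lintegral_prod _ hf.aemeasurable, lintegral_prod _ hg.aemeasurable,
    lintegral_prod _ hh.aemeasurable]
  refine hE ha hb hab hf.lintegral_prod_right' hg.lintegral_prod_right' hh.lintegral_prod_right'
    fun x₁ x₂ => ?_
  exact hF ha hb hab (hf.comp measurable_prodMk_left) (hg.comp measurable_prodMk_left)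
    (hh.comp measurable_prodMk_left) fun y₁ y₂ => hfgh (x₁, y₁) (x₂, y₂)

theorem PrekopaLeindler.of_measurePreserving {E F : Type*} [AddCommGroup E] [Module ℝ E]
    [MeasureSpace E] [AddCommGroup F] [Module ℝ F] [MeasureSpace F] (hE : PrekopaLeindler E)
    (e : E → F) (he : MeasurePreserving e)
    (hlin : ∀ (a b : ℝ) (x y : E), e (a • x + b • y) = a • e x + b • e y) :
    PrekopaLeindler F := by
  intro a b ha hb hab f g h hf hg hh hfgh
  rw [← he.lintegral_comp hf, ← he.lintegral_comp hg, ← he.lintegral_comp hh]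
  refine hE ha hb hab (hf.comp he.measurable) (hg.comp he.measurable) (hh.comp he.measurable)
    fun x y => ?_
  simp only [hlin]
  exact hfgh _ _

theorem prekopaLeindler_pi (n : ℕ) : PrekopaLeindler (Fin n → ℝ) := by
  induction n with
  | zero =>
    intro a b ha hb hab f g h hf hg hh hfgh
    rw [volume_pi, Measure.pi_of_empty _ 0, lintegral_dirac' _ hf, lintegral_dirac' _ hg,
      lintegral_dirac' _ hh]
    simpa using hfgh 0 0
  | succ n ih =>
    refine (prekopaLeindler_real.prod ih).of_measurePreserving
      (MeasurableEquiv.piFinSuccAbove (fun _ => ℝ) 0).symm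
      (volume_preserving_piFinSuccAbove (fun _ => ℝ) 0).symm fun a b x y => ?_
    ext i
    refine Fin.cases ?_ (fun j => ?_) i <;> simp [MeasurableEquiv.piFinSuccAbove]

theorem prekopaLeindler_euclideanSpace (n : ℕ) : PrekopaLeindler (EuclideanSpace ℝ (Fin n)) :=
  (prekopaLeindler_pi n).of_measurePreserving (WithLp.toLp 2)
    (PiLp.volume_preserving_toLp (Fin n)) fun _ _ _ _ => rfl

end PrekopaLeindler

section StrongConvexity

variable {V : Type*} [NormedAddCommGroup V] [InnerProductSpace ℝ V] [CompleteSpace V]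
  {U : V → ℝ} {μ : ℝ}

lemma hasDerivAt_comp_lineMap_sub_sq (hdiff : Differentiable ℝ U) (v w : V) (t : ℝ) :
    HasDerivAt (fun t : ℝ => U (w + t • (v - w)) - μ / 2 * ‖v - w‖ ^ 2 * t ^ 2)
      (⟪gradient U (w + t • (v - w)), v - w⟫_ℝ - μ * ‖v - w‖ ^ 2 * t) t := by
  have h1 : HasDerivAt (fun t : ℝ => w + t • (v - w)) (v - w) t := by
    simpa using ((hasDerivAt_id t).smul_const (v - w)).const_add w
  have h2 := (hdiff (w + t • (v - w))).hasGradientAt.hasFDerivAt.comp_hasDerivAt t h1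
  have h3 := h2.sub (((hasDerivAt_id t).pow 2).const_mul (μ / 2 * ‖v - w‖ ^ 2))
  refine h3.congr_deriv ?_
  simp
  ring

lemma convexOn_comp_lineMap_sub_sq (hdiff : Differentiable ℝ U)
    (hmono : ∀ v v' : V, μ * ‖v - v'‖ ^ 2 ≤ ⟪v - v', gradient U v - gradient U v'⟫_ℝ) (v w : V) :
    ConvexOn ℝ Set.univ (fun t : ℝ => U (w + t • (v - w)) - μ / 2 * ‖v - w‖ ^ 2 * t ^ 2) := by
  have hd := hasDerivAt_comp_lineMap_sub_sq (μ := μ) hdiff v w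
  refine Monotone.convexOn_univ_of_deriv (fun t => (hd t).differentiableAt) fun s t hst => ?_
  rw [(hd s).deriv, (hd t).deriv]
  rcases hst.eq_or_lt with rfl | hst
  · rfl
  have h := hmono (w + t • (v - w)) (w + s • (v - w))
  rw [add_sub_add_left_eq_sub, ← sub_smul, norm_smul, real_inner_smul_left, mul_pow,
    Real.norm_eq_abs, sq_abs, real_inner_comm, inner_sub_left] at h
  have h' : (t - s) * (μ * ((t - s) * ‖v - w‖ ^ 2)) ≤
      (t - s) * (⟪gradient U (w + t • (v - w)), v - w⟫_ℝ -
        ⟪gradient U (w + s • (v - w)), v - w⟫_ℝ) := by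
    linarith
  have := le_of_mul_le_mul_left h' (sub_pos.2 hst)
  linarith

lemma strongly_convex_of_gradient_mono (hdiff : Differentiable ℝ U)
    (hmono : ∀ v v' : V, μ * ‖v - v'‖ ^ 2 ≤ ⟪v - v', gradient U v - gradient U v'⟫_ℝ)
    {a b : ℝ} (ha : 0 ≤ a) (hb : 0 ≤ b) (hab : a + b = 1) (v w : V) :
    U (a • v + b • w) ≤ a * U v + b * U w - μ / 2 * (a * b) * ‖v - w‖ ^ 2 := by
  have h := (convexOn_comp_lineMap_sub_sq hdiff hmono v w).2 (Set.mem_univ 1) (Set.mem_univ 0)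
    ha hb hab
  obtain rfl : b = 1 - a := by linarith
  have he : w + a • (v - w) = a • v + (1 - a) • w := by module
  simp only [smul_eq_mul, mul_one, mul_zero, add_zero, one_smul, zero_smul, he,
    add_sub_cancel] at h
  linarith

lemma add_inner_gradient_add_sq_le (hdiff : Differentiable ℝ U)
    (hmono : ∀ v v' : V, μ * ‖v - v'‖ ^ 2 ≤ ⟪v - v', gradient U v - gradient U v'⟫_ℝ) (v w : V) :
    U w + ⟪gradient U w, v - w⟫_ℝ + μ / 2 * ‖v - w‖ ^ 2 ≤ U v := by
  have h := (convexOn_comp_lineMap_sub_sq hdiff hmono v w).le_slope_of_hasDerivAt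
    (Set.mem_univ 0) (Set.mem_univ 1) zero_lt_one (hasDerivAt_comp_lineMap_sub_sq hdiff v w 0)
  simp only [slope_def_field, zero_smul, add_zero, one_smul, add_sub_cancel] at h
  linarith

end StrongConvexity

section SecondMoment

open Module Filter Topology

variable {E : Type*} [NormedAddCommGroup E] [InnerProductSpace ℝ E] [FiniteDimensional ℝ E]
  [MeasurableSpace E] [BorelSpace E]

lemma lintegral_comp_smul_add (ν : Measure E) [ν.IsAddHaarMeasure] {f : E → ℝ≥0∞}
    (hf : Measurable f) {s : ℝ} (hs : 0 < s) (v : E) :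
    ∫⁻ x, f (s • x + v) ∂ν = ENNReal.ofReal ((s ^ finrank ℝ E)⁻¹) * ∫⁻ x, f x ∂ν := by
  rw [← lintegral_add_right_eq_self (μ := ν) f v,
    ← lintegral_map (f := fun x => f (x + v)) (g := fun x => s • x) (by fun_prop) (by fun_prop),
    Measure.map_addHaar_smul ν hs.ne', lintegral_smul_measure, abs_of_pos (by positivity),
    smul_eq_mul]

/-- If the density `p` of a probability measure grows at least as fast towards `x₀` as an
`m`-strongly log-concave density with mode `x₀`, then its second moment about `x₀` is at most
`2 * finrank ℝ E / m`. -/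
lemma lintegral_sq_norm_sub_mul_le (ν : Measure E) [ν.IsAddHaarMeasure] {p : E → ℝ}
    (hp : Measurable p) (hp0 : ∀ x, 0 ≤ p x) (hp1 : ∫⁻ x, ENNReal.ofReal (p x) ∂ν = 1)
    {m : ℝ} (hm : 0 < m) (x₀ : E)
    (h : ∀ s ∈ Set.Ioo (0 : ℝ) 1, ∀ x,
      p x * (1 + m / 2 * (s * (1 - s)) * ‖x - x₀‖ ^ 2) ≤ p (s • x + (1 - s) • x₀)) :
    ∫⁻ x, ENNReal.ofReal (p x) * ENNReal.ofReal (‖x - x₀‖ ^ 2) ∂ν ≤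
      ENNReal.ofReal (2 * finrank ℝ E / m) := by
  set d := finrank ℝ E
  set M := ∫⁻ x, ENNReal.ofReal (p x) * ENNReal.ofReal (‖x - x₀‖ ^ 2) ∂ν with hM
  have key : ∀ s ∈ Set.Ioo (0 : ℝ) 1,
      1 + ENNReal.ofReal (m / 2 * (s * (1 - s))) * M ≤ ENNReal.ofReal ((s ^ d)⁻¹) := by
    intro s hs
    have h1s : 0 < 1 - s := sub_pos.2 hs.2
    have hs0 := hs.1
    calc 1 + ENNReal.ofReal (m / 2 * (s * (1 - s))) * M
        = ∫⁻ x, ENNReal.ofReal (p x * (1 + m / 2 * (s * (1 - s)) * ‖x - x₀‖ ^ 2)) ∂ν := by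
          rw [← hp1, hM, ← lintegral_const_mul _ (by fun_prop), ← lintegral_add_left (by fun_prop)]
          refine lintegral_congr fun x => ?_
          rw [ENNReal.ofReal_mul (hp0 x), ENNReal.ofReal_add zero_le_one (by positivity),
            ENNReal.ofReal_mul (p := m / 2 * (s * (1 - s))) (by positivity), ENNReal.ofReal_one]
          ring
      _ ≤ ∫⁻ x, ENNReal.ofReal (p (s • x + (1 - s) • x₀)) ∂ν :=
          lintegral_mono fun x => ENNReal.ofReal_le_ofReal (h s hs x)
      _ = ENNReal.ofReal ((s ^ d)⁻¹) := by
          rw [lintegral_comp_smul_add ν hp.ennreal_ofReal hs.1, hp1, mul_one]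
  have hMtop : M ≠ ∞ := by
    intro htop
    have := key (1 / 2) (by norm_num)
    rw [htop, ENNReal.mul_top (by simpa using by positivity), add_top, top_le_iff] at this
    exact ENNReal.ofReal_ne_top this
  have hreal : ∀ s ∈ Set.Ioo (0 : ℝ) 1, s ^ (d + 1) * M.toReal ≤ 2 * d / m := by
    intro s hs
    have h1s : 0 < 1 - s := sub_pos.2 hs.2
    have hs0 := hs.1
    have h1 := key s hs
    rw [← ENNReal.ofReal_toReal hMtop, ← ENNReal.ofReal_mul (by positivity), ← ENNReal.ofReal_one,
      ← ENNReal.ofReal_add zero_le_one (by positivity),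
      ENNReal.ofReal_le_ofReal_iff (by positivity), le_inv_comm₀ (by positivity) (by positivity),
      ← one_div, le_div_iff₀ (by positivity)] at h1
    have hbern : 1 - d * (1 - s) ≤ s ^ d := by
      have := one_add_mul_le_pow (a := s - 1) (by linarith) d
      rw [add_sub_cancel] at this
      linarith
    rw [le_div_iff₀ hm]
    refine le_of_mul_le_mul_right ?_ h1s
    rw [pow_succ]
    linarith
  rw [← ENNReal.ofReal_toReal hMtop]
  refine ENNReal.ofReal_le_ofReal ?_
  have hlim : Tendsto (fun s : ℝ => s ^ (d + 1) * M.toReal) (𝓝[<] 1) (𝓝 (1 ^ (d + 1) * M.toReal)) :=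
    ((continuous_id.pow _).mul continuous_const).continuousWithinAt.tendsto
  rw [one_pow, one_mul] at hlim
  refine le_of_tendsto hlim ?_
  filter_upwards [Ioo_mem_nhdsLT (zero_lt_one' ℝ)] with s hs using hreal s hs

end SecondMoment

section MarginalLik

variable {dθ dx : ℕ} {U : PairSp dθ dx → ℝ} {μ : ℝ}

lemma Differentiable.continuous_pairSp (hdiff : Differentiable ℝ U) : Continuous U := by
  have hcont {V : Type} [NormedAddCommGroup V] [InnerProductSpace ℝ V] {f : V → ℝ}
    (hf : Differentiable ℝ f) : Continuous f := hf.continuous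
  exact hcont hdiff

lemma continuous_mkPair : Continuous fun p : EuclideanSpace ℝ (Fin dθ) × EuclideanSpace ℝ (Fin dx) =>
    mkPair p.1 p.2 :=
  WithLp.prod_continuous_toLp 2 _ _

lemma integrable_exp_neg_mkPair (hμ : 0 < μ) (hdiff : Differentiable ℝ U)
    (hmono : ∀ v v' : PairSp dθ dx,
      μ * ‖v - v'‖ ^ 2 ≤ ⟪v - v', gradient U v - gradient U v'⟫_ℝ)
    (θ : EuclideanSpace ℝ (Fin dθ)) :
    Integrable fun x : EuclideanSpace ℝ (Fin dx) => Real.exp (-U (mkPair θ x)) := by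
  set w : PairSp dθ dx := mkPair θ 0
  have hgauss := ((GaussianFourier.integrable_cexp_neg_mul_sq_norm_add
    (V := EuclideanSpace ℝ (Fin dx)) (b := (μ / 2 : ℝ)) (by simpa using hμ) (-1)
    (gradient U w).snd).norm.const_mul (Real.exp (-U w)))
  refine hgauss.mono' ?_ (Filter.Eventually.of_forall fun x => ?_)
  · refine Continuous.aestronglyMeasurable (Real.continuous_exp.comp ?_)
    exact (hdiff.continuous_pairSp.comp (continuous_mkPair.comp (Continuous.prodMk_right θ))).neg
  · have h := add_inner_gradient_add_sq_le hdiff hmono (mkPair θ x) w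
    have hsub : mkPair θ x - w = mkPair 0 x := by
      refine WithLp.ofLp_injective 2 (Prod.ext ?_ ?_)
      · exact sub_self θ
      · exact sub_zero x
    rw [hsub, WithLp.prod_inner_apply, WithLp.prod_norm_sq_eq_of_L2] at h
    simp [mkPair] at h
    rw [Complex.norm_exp, ← Real.exp_add, Real.norm_eq_abs, Real.abs_exp, Real.exp_le_exp]
    norm_cast
    simp [mkPair]
    linarith

lemma marginalLik_pos (hμ : 0 < μ) (hdiff : Differentiable ℝ U)
    (hmono : ∀ v v' : PairSp dθ dx,
      μ * ‖v - v'‖ ^ 2 ≤ ⟪v - v', gradient U v - gradient U v'⟫_ℝ)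
    (θ : EuclideanSpace ℝ (Fin dθ)) : 0 < marginalLik U θ :=
  integral_exp_pos (integrable_exp_neg_mkPair hμ hdiff hmono θ)

lemma ofReal_marginalLik (hμ : 0 < μ) (hdiff : Differentiable ℝ U)
    (hmono : ∀ v v' : PairSp dθ dx,
      μ * ‖v - v'‖ ^ 2 ≤ ⟪v - v', gradient U v - gradient U v'⟫_ℝ)
    (θ : EuclideanSpace ℝ (Fin dθ)) :
    ENNReal.ofReal (marginalLik U θ) = ∫⁻ x, ENNReal.ofReal (Real.exp (-U (mkPair θ x))) :=
  ofReal_integral_eq_lintegral_ofReal (integrable_exp_neg_mkPair hμ hdiff hmono θ)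
    (Filter.Eventually.of_forall fun _ => (Real.exp_pos _).le)

lemma measurable_marginalLik (hU : Continuous U) : Measurable (marginalLik U) :=
  (StronglyMeasurable.integral_prod_right (ν := volume)
    (f := fun θ (x : EuclideanSpace ℝ (Fin dx)) => Real.exp (-U (mkPair θ x)))
    (Real.continuous_exp.comp (hU.comp continuous_mkPair).neg).stronglyMeasurable).measurable

/-- The marginal of a `μ`-strongly log-concave function is `μ`-strongly log-concave. -/
lemma marginalLik_rpow_mul_rpow_mul_exp_le (hμ : 0 < μ) (hdiff : Differentiable ℝ U)
    (hmono : ∀ v v' : PairSp dθ dx,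
      μ * ‖v - v'‖ ^ 2 ≤ ⟪v - v', gradient U v - gradient U v'⟫_ℝ)
    {a b : ℝ} (ha : 0 < a) (hb : 0 < b) (hab : a + b = 1) (θ θ' : EuclideanSpace ℝ (Fin dθ)) :
    marginalLik U θ ^ a * marginalLik U θ' ^ b * Real.exp (μ / 2 * (a * b) * ‖θ - θ'‖ ^ 2) ≤
      marginalLik U (a • θ + b • θ') := by
  have hpos := marginalLik_pos hμ hdiff hmono
  set r := μ / 2 * (a * b) * ‖θ - θ'‖ ^ 2
  have hmeas : ∀ ϑ : EuclideanSpace ℝ (Fin dθ),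
      Measurable fun x : EuclideanSpace ℝ (Fin dx) => ENNReal.ofReal (Real.exp (-U (mkPair ϑ x))) :=
    fun ϑ => (Real.continuous_exp.comp (hdiff.continuous_pairSp.comp
      (continuous_mkPair.comp (Continuous.prodMk_right ϑ))).neg).measurable.ennreal_ofReal
  have h := prekopaLeindler_euclideanSpace dx ha hb hab (hmeas θ) (hmeas θ')
    ((hmeas (a • θ + b • θ')).const_mul (ENNReal.ofReal (Real.exp (-r)))) fun x y => ?_
  · rw [lintegral_const_mul _ (hmeas _), ← ofReal_marginalLik hμ hdiff hmono,
      ← ofReal_marginalLik hμ hdiff hmono, ← ofReal_marginalLik hμ hdiff hmono,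
      ENNReal.ofReal_rpow_of_pos (hpos _), ENNReal.ofReal_rpow_of_pos (hpos _),
      ← ENNReal.ofReal_mul (Real.rpow_nonneg (hpos _).le _),
      ← ENNReal.ofReal_mul (Real.exp_pos _).le,
      ENNReal.ofReal_le_ofReal_iff (mul_pos (Real.exp_pos _) (hpos _)).le, Real.exp_neg,
      ← div_eq_inv_mul, le_div_iff₀ (Real.exp_pos _)] at h
    exact h
  · rw [ENNReal.ofReal_rpow_of_pos (Real.exp_pos _), ENNReal.ofReal_rpow_of_pos (Real.exp_pos _),
      ← ENNReal.ofReal_mul (Real.rpow_nonneg (Real.exp_pos _).le _),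
      ← ENNReal.ofReal_mul (Real.exp_pos _).le, ← Real.exp_mul, ← Real.exp_mul, ← Real.exp_add,
      ← Real.exp_add]
    refine ENNReal.ofReal_le_ofReal (Real.exp_le_exp.2 ?_)
    have hconv := strongly_convex_of_gradient_mono hdiff hmono ha.le hb.le hab
      (mkPair θ x) (mkPair θ' y)
    have hcomb : a • mkPair θ x + b • mkPair θ' y = mkPair (a • θ + b • θ') (a • x + b • y) := rfl
    have hnorm : ‖θ - θ'‖ ^ 2 ≤ ‖mkPair θ x - mkPair θ' y‖ ^ 2 := by
      rw [WithLp.prod_norm_sq_eq_of_L2]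
      exact le_add_of_nonneg_right (sq_nonneg _)
    have hr : r ≤ μ / 2 * (a * b) * ‖mkPair θ x - mkPair θ' y‖ ^ 2 :=
      mul_le_mul_of_nonneg_left hnorm (by positivity)
    rw [hcomb] at hconv
    linarith

end MarginalLik

/-- concentration of the invariant measure: if `π^N_Θ` is the probability
measure on `ℝ^{d_θ}` with Lebesgue density proportional to `k(θ)^N` and `θ*` is the global
minimiser of `κ = -log k`, then the second moment of `π^N_Θ` around `θ*` is at most
`2 d_θ / (μ N)`; equivalently `W₂(π^N_Θ, δ_{θ*}) ≤ √(2 d_θ / (μ N))`. -/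
theorem invariant_measure_concentration
    {dθ dx : ℕ} (hdθ : 1 ≤ dθ) (hdx : 1 ≤ dx) (Lθ Lx μ : ℝ)
    (hLθ : 0 < Lθ) (hLx : 0 < Lx) (hμ : 0 < μ)
    (U : PairSp dθ dx → ℝ) (hdiff : Differentiable ℝ U)
    (hlip : ∀ (θ θ' : EuclideanSpace ℝ (Fin dθ)) (x x' : EuclideanSpace ℝ (Fin dx)),
      ‖gradient U (mkPair θ x) - gradient U (mkPair θ' x')‖ ≤ Lθ * ‖θ - θ'‖ + Lx * ‖x - x'‖)
    (hmono : ∀ v v' : PairSp dθ dx,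
      μ * ‖v - v'‖ ^ 2 ≤ ⟪v - v', gradient U v - gradient U v'⟫_ℝ)
    (N : ℕ) (hN : 1 ≤ N)
    (θstar : EuclideanSpace ℝ (Fin dθ))
    (hmin : ∀ θ : EuclideanSpace ℝ (Fin dθ),
      -Real.log (marginalLik U θstar) ≤ -Real.log (marginalLik U θ))
    (π : Measure (EuclideanSpace ℝ (Fin dθ))) (c : ℝ) (hc : 0 < c)
    (hπ : π = volume.withDensity fun θ => ENNReal.ofReal (c * marginalLik U θ ^ N))
    (hprob : IsProbabilityMeasure π) :
    ∫⁻ θ, ENNReal.ofReal (‖θ - θstar‖ ^ 2) ∂π ≤ ENNReal.ofReal (2 * dθ / (μ * N)) := by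
  have hpos := marginalLik_pos hμ hdiff hmono
  have hmeas : Measurable fun θ => c * marginalLik U θ ^ N :=
    ((measurable_marginalLik hdiff.continuous_pairSp).pow_const N).const_mul c
  have hN0 : (0 : ℝ) < N := by exact_mod_cast hN
  have hp1 : ∫⁻ θ, ENNReal.ofReal (c * marginalLik U θ ^ N) = 1 := by
    rw [← setLIntegral_univ, ← withDensity_apply _ MeasurableSet.univ, ← hπ]
    exact measure_univ
  rw [hπ, lintegral_withDensity_eq_lintegral_mul _ hmeas.ennreal_ofReal (by fun_prop)]
  have h := lintegral_sq_norm_sub_mul_le volume hmeas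
    (fun θ => (mul_pos hc (pow_pos (hpos θ) N)).le) hp1 (mul_pos hμ hN0) θstar fun s hs θ => ?_
  · rwa [finrank_euclideanSpace_fin] at h
  have h1s : 0 < 1 - s := sub_pos.2 hs.2
  set r := μ / 2 * (s * (1 - s)) * ‖θ - θstar‖ ^ 2 with hr
  have hle : marginalLik U θ ≤ marginalLik U θstar :=
    (Real.log_le_log_iff (hpos _) (hpos _)).1 (neg_le_neg_iff.1 (hmin θ))
  have hk : marginalLik U θ * Real.exp r ≤ marginalLik U (s • θ + (1 - s) • θstar) := by
    refine le_trans ?_ (marginalLik_rpow_mul_rpow_mul_exp_le hμ hdiff hmono hs.1 h1s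
      (add_sub_cancel s 1) θ θstar)
    refine mul_le_mul_of_nonneg_right ?_ (Real.exp_pos _).le
    calc marginalLik U θ = marginalLik U θ ^ s * marginalLik U θ ^ (1 - s) := by
          rw [← Real.rpow_add (hpos θ), add_sub_cancel, Real.rpow_one]
      _ ≤ _ := mul_le_mul_of_nonneg_left (Real.rpow_le_rpow (hpos θ).le hle h1s.le)
          (Real.rpow_nonneg (hpos θ).le _)
  calc c * marginalLik U θ ^ N * (1 + μ * N / 2 * (s * (1 - s)) * ‖θ - θstar‖ ^ 2)
      = c * marginalLik U θ ^ N * (N * r + 1) := by rw [hr]; ring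
    _ ≤ c * marginalLik U θ ^ N * Real.exp (N * r) :=
        mul_le_mul_of_nonneg_left (Real.add_one_le_exp _) (mul_pos hc (pow_pos (hpos θ) N)).le
    _ = c * (marginalLik U θ * Real.exp r) ^ N := by rw [Real.exp_nat_mul]; ring
    _ ≤ c * marginalLik U (s • θ + (1 - s) • θstar) ^ N :=
        mul_le_mul_of_nonneg_left
          (pow_le_pow_left₀ (mul_pos (hpos θ) (Real.exp_pos _)).le hk N) hc.le
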